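/- Let α ∈ (0,1), β ∈ (α,1), and let u : ℝ → (0,∞) be a function of class C^{1,β} with 0 < m₁ ≤ u ≤ m₂ for two positive constants m₁, m₂. Let E = {(s₁,s₂) ∈ ℝ² : −u(s₁) < s₂ < u(s₁)}. Then for every s ∈ ℝ, at the boundary point x = (s, u(s)) ∈ ∂E the principal-value limit defining H_E(x) exists, the principal-value limit lim_{ε→0} ∫_{{|t| ≥ ε}} F( (u(s) − u(s−t))/|t| ) |t|^{−1−α} dt exists, the integral ∫_ℝ ( F( (u(s) + u(s−t))/|t| ) − F(+∞) ) |t|^{−1−α} dt converges absolutely, and H_E((s,u(s))) = 2 lim_{ε→0} ∫_{{|t| ≥ ε}} F( (u(s) − u(s−t))/|t| ) |t|^{−1−α} dt − 2 ∫_ℝ ( F( (u(s) + u(s−t))/|t| ) − F(+∞) ) |t|^{−1−α} dt. -/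

import Mathlib

open MeasureTheory Filter Topology Classical Real

/-- `τ_E = 1_E − 1_{E^c}` in the plane. -/
noncomputable def tauE (E : Set (EuclideanSpace ℝ (Fin 2))) (y : EuclideanSpace ℝ (Fin 2)) : ℝ :=
  if y ∈ E then 1 else -1

/-- `F(q) = ∫_0^q (1+τ²)^{−(2+α)/2} dτ`. -/
noncomputable def Fa (α q : ℝ) : ℝ := ∫ τ in (0:ℝ)..q, (1 + τ ^ 2) ^ (-(2 + α) / 2)

/-- `F(+∞) = ∫_0^∞ (1+τ²)^{−(2+α)/2} dτ`. -/
noncomputable def FaInf (α : ℝ) : ℝ := ∫ τ in Set.Ioi (0:ℝ), (1 + τ ^ 2) ^ (-(2 + α) / 2)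

/-- The point `(a, b) ∈ ℝ²`. -/
noncomputable def pt2 (a b : ℝ) : EuclideanSpace ℝ (Fin 2) :=
  (EuclideanSpace.equiv (Fin 2) ℝ).symm ![a, b]

namespace NMC

/-- the one-dimensional profile -/
noncomputable def kk (α τ : ℝ) : ℝ := (1 + τ ^ 2) ^ (-(2 + α) / 2)

lemma kk_pos (α τ : ℝ) : 0 < kk α τ := by unfold kk; positivity

lemma kk_cont (α : ℝ) : Continuous (kk α) := by
  unfold kk
  refine Continuous.rpow_const (by fun_prop) ?_
  intro x; left; positivity

lemma kk_le_one {α : ℝ} (hα : 0 < α) (τ : ℝ) : kk α τ ≤ 1 := by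
  unfold kk
  apply Real.rpow_le_one_of_one_le_of_nonpos
  · nlinarith [sq_nonneg τ]
  · linarith

lemma kk_int {α : ℝ} (hα : 0 < α) : Integrable (kk α) := by
  have h := integrable_rpow_neg_one_add_norm_sq (E := ℝ) (μ := volume) (r := 2 + α)
    (by simp; linarith)
  refine h.congr (Filter.Eventually.of_forall fun x => ?_)
  simp [kk]

lemma kk_neg (α τ : ℝ) : kk α (-τ) = kk α τ := by simp [kk]

lemma kk_total (α : ℝ) : ∫ τ, kk α τ = 2 * FaInf α := by
  have := integral_comp_abs (f := kk α)
  simpa [kk, FaInf] using this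

lemma Fa_eq (α q : ℝ) : Fa α q = ∫ τ in (0:ℝ)..q, kk α τ := rfl
lemma FaInf_eq (α : ℝ) : FaInf α = ∫ τ in Set.Ioi (0:ℝ), kk α τ := rfl

lemma Fa_sub (α a b : ℝ) : Fa α b - Fa α a = ∫ τ in a..b, kk α τ := by
  rw [Fa_eq, Fa_eq]
  exact intervalIntegral.integral_interval_sub_left ((kk_cont α).intervalIntegrable _ _)
    ((kk_cont α).intervalIntegrable _ _)

lemma Fa_lip {α : ℝ} (hα : 0 < α) (a b : ℝ) : |Fa α b - Fa α a| ≤ |b - a| := by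
  rw [Fa_sub]
  have := intervalIntegral.norm_integral_le_of_norm_le_const (a := a) (b := b) (f := kk α) (C := 1)
    (fun x _ => by rw [Real.norm_of_nonneg (kk_pos α x).le]; exact kk_le_one hα x)
  simpa using this

lemma Fa_cont {α : ℝ} (hα : 0 < α) : Continuous (Fa α) := by
  have : LipschitzWith 1 (Fa α) := by
    apply LipschitzWith.of_dist_le_mul
    intro x y
    simp only [Real.dist_eq, NNReal.coe_one, one_mul]
    exact Fa_lip hα y x
  exact this.continuous

lemma Fa_neg (α q : ℝ) : Fa α (-q) = -Fa α q := by
  rw [Fa_eq, Fa_eq]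
  have := intervalIntegral.integral_comp_neg (a := 0) (b := q) (kk α)
  simp only [kk_neg, neg_zero] at this
  rw [this, intervalIntegral.integral_symm]

lemma Fa_tail {α : ℝ} (hα : 0 < α) (q : ℝ) : FaInf α - Fa α q = ∫ τ in Set.Ioi q, kk α τ := by
  have h0 := intervalIntegral.integral_Iic_sub_Iic (a := 0) (b := q) (f := kk α) (μ := volume)
    (kk_int hα).integrableOn (kk_int hα).integrableOn
  have h1 := integral_add_compl (measurableSet_Iic (a := q)) (kk_int hα)
  have h2 := integral_add_compl (measurableSet_Iic (a := (0:ℝ))) (kk_int hα)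
  rw [Set.compl_Iic] at h1 h2
  rw [FaInf_eq, Fa_eq]; linarith

lemma Fa_le {α : ℝ} (hα : 0 < α) (q : ℝ) : Fa α q ≤ FaInf α := by
  have h := Fa_tail hα q
  have : 0 ≤ ∫ τ in Set.Ioi q, kk α τ := integral_nonneg fun x => (kk_pos α x).le
  linarith

lemma Fa_abs {α : ℝ} (hα : 0 < α) (q : ℝ) : |Fa α q| ≤ FaInf α := by
  rw [abs_le]
  have := Fa_le hα q
  have := Fa_le hα (-q)
  rw [Fa_neg] at this
  constructor <;> linarith

lemma Fa_tail_le {α : ℝ} (hα : 0 < α) {q : ℝ} (hq : 0 < q) :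
    FaInf α - Fa α q ≤ q ^ (-(1 + α)) := by
  rw [Fa_tail hα]
  have h1 : ∫ τ in Set.Ioi q, kk α τ ≤ ∫ τ in Set.Ioi q, τ ^ (-(2 + α)) := by
    refine setIntegral_mono_on (kk_int hα).integrableOn
      (integrableOn_Ioi_rpow_of_lt (by linarith) hq) measurableSet_Ioi ?_
    intro x hx
    have hx0 : 0 < x := hq.trans hx
    have e : x ^ (-(2 + α)) = (x ^ 2) ^ (-(2 + α) / 2) := by
      rw [← Real.rpow_natCast, ← Real.rpow_mul hx0.le]; congr 1; push_cast; ring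
    rw [e]
    unfold kk
    apply Real.rpow_le_rpow_of_nonpos (by positivity) (by linarith) (by linarith)
  refine h1.trans ?_
  rw [integral_Ioi_rpow_of_lt (by linarith) hq]
  have e : -(2 + α) + 1 = -(1 + α) := by ring
  rw [e, neg_div_neg_eq]
  apply div_le_self (by positivity) (by linarith)

lemma sign_bdd (x : ℝ) : |Real.sign x| ≤ 1 := by
  rcases Real.sign_apply_eq x with h | h | h <;> simp [h]

lemma sign_meas : Measurable Real.sign := by
  unfold Real.sign
  exact Measurable.ite measurableSet_Iio measurable_const
    (Measurable.ite measurableSet_Ioi measurable_const measurable_const)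

lemma sign_int {α : ℝ} (hα : 0 < α) (q : ℝ) :
    Integrable fun τ => Real.sign (q - τ) * kk α τ :=
  (kk_int hα).bdd_mul (c := 1)
    (sign_meas.comp (measurable_const.sub measurable_id)).aestronglyMeasurable
    (Eventually.of_forall fun _ => sign_bdd _)

lemma sign_integral {α : ℝ} (hα : 0 < α) (q : ℝ) :
    ∫ τ, Real.sign (q - τ) * kk α τ = 2 * Fa α q := by
  rw [← integral_add_compl (measurableSet_Iic (a := q)) (sign_int hα q)]
  have h1 : ∫ τ in Set.Iic q, Real.sign (q - τ) * kk α τ = ∫ τ in Set.Iic q, kk α τ := by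
    rw [integral_Iic_eq_integral_Iio, integral_Iic_eq_integral_Iio]
    refine setIntegral_congr_fun measurableSet_Iio fun x hx => ?_
    have : 0 < q - x := sub_pos.2 hx
    simp [Real.sign_of_pos this]
  have h2 : ∫ τ in (Set.Iic q)ᶜ, Real.sign (q - τ) * kk α τ = -∫ τ in Set.Ioi q, kk α τ := by
    rw [Set.compl_Iic, ← integral_neg]
    refine setIntegral_congr_fun measurableSet_Ioi fun x hx => ?_
    have : q - x < 0 := sub_neg.2 hx
    simp [Real.sign_of_neg this]
  rw [h1, h2, ← Fa_tail hα]
  have h3 := integral_add_compl (measurableSet_Iic (a := q)) (kk_int hα)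
  rw [Set.compl_Iic, ← Fa_tail hα, kk_total] at h3
  linarith

/-- the kernel at horizontal distance `t` -/
lemma KK_eq {α t : ℝ} (ht : t ≠ 0) (z : ℝ) :
    (t ^ 2 + z ^ 2) ^ (-(2 + α) / 2) = |t| ^ (-(2 + α)) * kk α (z / |t|) := by
  have h0 : 0 < |t| := abs_pos.2 ht
  have e : |t| ^ (-(2 + α)) = (|t| ^ 2) ^ (-(2 + α) / 2) := by
    rw [← Real.rpow_natCast, ← Real.rpow_mul h0.le]; congr 1; push_cast; ring
  rw [e, kk, ← Real.mul_rpow (by positivity) (by positivity)]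
  congr 1
  field_simp
  rw [sq_abs]

lemma sign_div {t : ℝ} (ht : t ≠ 0) (c : ℝ) : Real.sign (c / |t|) = Real.sign c := by
  have h0 : 0 < |t| := abs_pos.2 ht
  rcases lt_trichotomy c 0 with h | h | h
  · rw [Real.sign_of_neg h, Real.sign_of_neg (div_neg_of_neg_of_pos h h0)]
  · simp [h]
  · rw [Real.sign_of_pos h, Real.sign_of_pos (div_pos h h0)]

lemma KK_int {α t : ℝ} (hα : 0 < α) (ht : t ≠ 0) :
    Integrable fun z : ℝ => (t ^ 2 + z ^ 2) ^ (-(2 + α) / 2) := by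
  simp only [KK_eq ht]
  exact ((kk_int hα).comp_div (abs_ne_zero.2 ht)).const_mul _

lemma pow_aux {α t : ℝ} (ht : t ≠ 0) : |t| ^ (-(2 + α)) * |t| = |t| ^ (-(1 + α)) := by
  have h0 : 0 < |t| := abs_pos.2 ht
  nth_rw 2 [← Real.rpow_one |t|]
  rw [← Real.rpow_add h0]; congr 1; ring

lemma KK_total {α t : ℝ} (ht : t ≠ 0) :
    ∫ z : ℝ, (t ^ 2 + z ^ 2) ^ (-(2 + α) / 2) = 2 * FaInf α * |t| ^ (-(1 + α)) := by
  simp only [KK_eq ht]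
  rw [integral_const_mul, Measure.integral_comp_div, kk_total, abs_abs, ← pow_aux ht, smul_eq_mul]
  ring

lemma KK_sign_int {α t : ℝ} (hα : 0 < α) (ht : t ≠ 0) (c : ℝ) :
    Integrable fun z : ℝ => Real.sign (c - z) * (t ^ 2 + z ^ 2) ^ (-(2 + α) / 2) :=
  (KK_int hα ht).bdd_mul (c := 1)
    (sign_meas.comp (measurable_const.sub measurable_id)).aestronglyMeasurable
    (Eventually.of_forall fun _ => sign_bdd _)

lemma KK_sign {α t : ℝ} (hα : 0 < α) (ht : t ≠ 0) (c : ℝ) :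
    ∫ z : ℝ, Real.sign (c - z) * (t ^ 2 + z ^ 2) ^ (-(2 + α) / 2)
      = 2 * Fa α (c / |t|) * |t| ^ (-(1 + α)) := by
  have : ∀ z, Real.sign (c - z) * (t ^ 2 + z ^ 2) ^ (-(2 + α) / 2) = |t| ^ (-(2 + α)) *
      ((fun τ => Real.sign (c / |t| - τ) * kk α τ) (z / |t|)) := by
    intro z
    rw [KK_eq ht]
    simp only
    rw [← sub_div, sign_div ht]; ring
  rw [integral_congr_ae (Eventually.of_forall this)]
  rw [integral_const_mul, Measure.integral_comp_div (fun τ => Real.sign (c / |t| - τ) * kk α τ),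
    sign_integral hα, abs_abs, ← pow_aux ht,
    smul_eq_mul]
  ring

lemma sign_mono : Monotone Real.sign := by
  intro x y h
  rcases lt_trichotomy x 0 with hx | hx | hx
  · rw [Real.sign_of_neg hx]; exact (abs_le.1 (sign_bdd y)).1
  · subst hx
    rcases h.eq_or_lt with h | h
    · rw [← h]
    · rw [Real.sign_of_pos h]; simp
  · rw [Real.sign_of_pos hx, Real.sign_of_pos (hx.trans_le h)]

/-- first slice: signs of `c - z` versus `d - z` -/
lemma slice1 {α t : ℝ} (hα : 0 < α) (ht : t ≠ 0) (c d : ℝ) :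
    Integrable (fun z : ℝ => (Real.sign (c - z) - Real.sign (d - z)) *
      (t ^ 2 + z ^ 2) ^ (-(2 + α) / 2)) ∧
    ∫ z : ℝ, (Real.sign (c - z) - Real.sign (d - z)) * (t ^ 2 + z ^ 2) ^ (-(2 + α) / 2)
      = 2 * ((Fa α (c / |t|) - Fa α (d / |t|)) * |t| ^ (-(1 + α))) ∧
    ∫ z : ℝ, ‖(Real.sign (c - z) - Real.sign (d - z)) * (t ^ 2 + z ^ 2) ^ (-(2 + α) / 2)‖
      = 2 * |(Fa α (c / |t|) - Fa α (d / |t|)) * |t| ^ (-(1 + α))| := by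
  have hi : ∀ c d : ℝ, Integrable (fun z : ℝ => (Real.sign (c - z) - Real.sign (d - z)) *
      (t ^ 2 + z ^ 2) ^ (-(2 + α) / 2)) := by
    intro c d
    simp only [sub_mul]
    exact (KK_sign_int hα ht c).sub (KK_sign_int hα ht d)
  have hv : ∀ c d : ℝ, ∫ z : ℝ, (Real.sign (c - z) - Real.sign (d - z)) *
      (t ^ 2 + z ^ 2) ^ (-(2 + α) / 2)
      = 2 * ((Fa α (c / |t|) - Fa α (d / |t|)) * |t| ^ (-(1 + α))) := by
    intro c d
    simp only [sub_mul]
    rw [integral_sub (KK_sign_int hα ht c) (KK_sign_int hα ht d), KK_sign hα ht, KK_sign hα ht]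
    ring
  have hn : ∀ c d : ℝ, d ≤ c →
    ∫ z : ℝ, ‖(Real.sign (c - z) - Real.sign (d - z)) * (t ^ 2 + z ^ 2) ^ (-(2 + α) / 2)‖
      = 2 * |(Fa α (c / |t|) - Fa α (d / |t|)) * |t| ^ (-(1 + α))| := by
    intro c d hcd
    have hnn : ∀ z, 0 ≤ (Real.sign (c - z) - Real.sign (d - z)) *
        (t ^ 2 + z ^ 2) ^ (-(2 + α) / 2) := fun z =>
      mul_nonneg (sub_nonneg.2 (sign_mono (by linarith))) (by positivity)
    simp only [Real.norm_of_nonneg (hnn _)]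
    have h0 : 0 ≤ 2 * ((Fa α (c / |t|) - Fa α (d / |t|)) * |t| ^ (-(1 + α))) := by
      rw [← hv]; exact integral_nonneg hnn
    have hv' := hv c d
    generalize (Fa α (c / |t|) - Fa α (d / |t|)) * |t| ^ (-(1 + α)) = w at h0 hv' ⊢
    rw [hv', abs_of_nonneg (by linarith)]
  refine ⟨hi c d, hv c d, ?_⟩
  rcases le_total d c with h | h
  · exact hn c d h
  · have := hn d c h
    rw [← abs_neg, ← neg_mul, neg_sub, ← this]
    refine integral_congr_ae (Eventually.of_forall fun z => ?_)
    simp only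
    rw [← norm_neg, ← neg_mul, neg_sub]

/-- second slice: sign of `Q + z` versus `1` -/
lemma slice2 {α t : ℝ} (hα : 0 < α) (ht : t ≠ 0) (Q : ℝ) :
    Integrable (fun z : ℝ => (Real.sign (Q + z) - 1) * (t ^ 2 + z ^ 2) ^ (-(2 + α) / 2)) ∧
    ∫ z : ℝ, (Real.sign (Q + z) - 1) * (t ^ 2 + z ^ 2) ^ (-(2 + α) / 2)
      = 2 * ((Fa α (Q / |t|) - FaInf α) * |t| ^ (-(1 + α))) ∧
    ∫ z : ℝ, ‖(Real.sign (Q + z) - 1) * (t ^ 2 + z ^ 2) ^ (-(2 + α) / 2)‖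
      = 2 * |(Fa α (Q / |t|) - FaInf α) * |t| ^ (-(1 + α))| := by
  have e : ∀ z : ℝ, Real.sign (Q + z) * (t ^ 2 + z ^ 2) ^ (-(2 + α) / 2) =
      (fun z => Real.sign (Q - z) * (t ^ 2 + z ^ 2) ^ (-(2 + α) / 2)) (-z) := by
    intro z; simp
  have h1 : Integrable fun z : ℝ => Real.sign (Q + z) * (t ^ 2 + z ^ 2) ^ (-(2 + α) / 2) := by
    simp only [e]
    exact (KK_sign_int hα ht Q).comp_neg
  have hi : Integrable
      (fun z : ℝ => (Real.sign (Q + z) - 1) * (t ^ 2 + z ^ 2) ^ (-(2 + α) / 2)) := by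
    simp only [sub_mul, one_mul]
    exact h1.sub (KK_int hα ht)
  have hv : ∫ z : ℝ, (Real.sign (Q + z) - 1) * (t ^ 2 + z ^ 2) ^ (-(2 + α) / 2)
      = 2 * ((Fa α (Q / |t|) - FaInf α) * |t| ^ (-(1 + α))) := by
    simp only [sub_mul, one_mul]
    rw [integral_sub h1 (KK_int hα ht), KK_total ht]
    simp only [e]
    rw [integral_neg_eq_self (fun z => Real.sign (Q - z) * (t ^ 2 + z ^ 2) ^ (-(2 + α) / 2)),
      KK_sign hα ht]
    ring
  refine ⟨hi, hv, ?_⟩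
  have hnn : ∀ z, (Real.sign (Q + z) - 1) * (t ^ 2 + z ^ 2) ^ (-(2 + α) / 2) ≤ 0 := fun z =>
    mul_nonpos_of_nonpos_of_nonneg (sub_nonpos.2 (abs_le.1 (sign_bdd _)).2) (by positivity)
  simp only [Real.norm_of_nonpos (hnn _)]
  rw [integral_neg, hv]
  have h0 : 2 * ((Fa α (Q / |t|) - FaInf α) * |t| ^ (-(1 + α))) ≤ 0 := by
    rw [← hv]; exact integral_nonpos hnn
  generalize (Fa α (Q / |t|) - FaInf α) * |t| ^ (-(1 + α)) = w at h0 ⊢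
  rw [abs_of_nonpos (by linarith)]
  ring

lemma far_int {E : Type*} [NormedAddCommGroup E] [NormedSpace ℝ E] [FiniteDimensional ℝ E]
    [MeasurableSpace E] [BorelSpace E] (μ : Measure E) [μ.IsAddHaarMeasure] {r : ℝ}
    (hr : (Module.finrank ℝ E : ℝ) < r) (x : E) {ε : ℝ} (hε : 0 < ε) :
    IntegrableOn (fun y => dist x y ^ (-r)) {y | ε ≤ dist y x} μ := by
  have hr0 : 0 < r := lt_of_le_of_lt (Nat.cast_nonneg _) hr
  have h := ((integrable_one_add_norm (μ := μ) hr).comp_sub_right x).const_mul ((1 / ε + 1) ^ r)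
  have hm : MeasurableSet {y : E | ε ≤ dist y x} :=
    measurableSet_le measurable_const (by fun_prop)
  refine Integrable.mono' h.integrableOn ?_ ?_
  · exact Measurable.aestronglyMeasurable (by fun_prop)
  · rw [ae_restrict_iff' hm]
    refine Eventually.of_forall fun y hy => ?_
    have hy : ε ≤ dist y x := hy
    rw [dist_comm x y, ← dist_eq_norm y x, Real.norm_of_nonneg (by positivity)]
    have hd : 0 < dist y x := hε.trans_le hy
    have h1 : 1 + dist y x ≤ (1 / ε + 1) * dist y x := by
      have : 1 ≤ 1 / ε * dist y x := by
        rw [one_div, ← div_eq_inv_mul, le_div_iff₀ hε]; linarith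
      linarith
    have h2 : ((1 / ε + 1) * dist y x) ^ (-r) ≤ (1 + dist y x) ^ (-r) :=
      Real.rpow_le_rpow_of_nonpos (by positivity) h1 (by linarith)
    rw [Real.mul_rpow (by positivity) hd.le] at h2
    calc dist y x ^ (-r) = (1 / ε + 1) ^ r * ((1 / ε + 1) ^ (-r) * dist y x ^ (-r)) := by
          rw [← mul_assoc, ← Real.rpow_add (by positivity)]; simp
      _ ≤ _ := by gcongr

lemma pv_lim {E : Type*} [MeasurableSpace E] {μ : Measure E} {f : E → ℝ} (hf : Integrable f μ)
    {N : E → ℝ} (hN : Measurable N) (hpos : ∀ᵐ y ∂μ, 0 < N y) :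
    Tendsto (fun ε : ℝ => ∫ y in {y | ε ≤ N y}, f y ∂μ) (𝓝[>] (0:ℝ)) (𝓝 (∫ y, f y ∂μ)) := by
  have hm : ∀ ε : ℝ, MeasurableSet {y | ε ≤ N y} := fun ε => measurableSet_le measurable_const hN
  simp only [← integral_indicator (hm _)]
  refine tendsto_integral_filter_of_dominated_convergence (fun y => ‖f y‖) ?_ ?_ hf.norm ?_
  · exact Eventually.of_forall fun ε => hf.aestronglyMeasurable.indicator (hm ε)
  · exact Eventually.of_forall fun ε => Eventually.of_forall fun y => norm_indicator_le_norm_self _ _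
  · filter_upwards [hpos] with y hy
    refine tendsto_const_nhds.congr' ?_
    filter_upwards [Ioo_mem_nhdsGT hy] with ε hε
    rw [Set.indicator_of_mem]
    exact hε.2.le

lemma near_int {γ : ℝ} (hγ : -1 < γ) :
    Integrable (fun t : ℝ => (Set.Iio (1:ℝ)).indicator (fun y => y ^ γ) |t|) := by
  have h := integrable_fun_norm_addHaar (E := ℝ) volume
    (f := (Set.Iio (1:ℝ)).indicator (fun y : ℝ => y ^ γ))
  simp only [Real.norm_eq_abs] at h
  rw [h]
  simp only [Module.finrank_self, tsub_self, pow_zero, one_smul]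
  rw [integrableOn_indicator_iff measurableSet_Iio]
  have := (intervalIntegral.intervalIntegrable_rpow' (a := 0) (b := 1) hγ).1
  refine this.mono_set ?_
  rintro x ⟨h1, h2⟩
  exact ⟨h2, le_of_lt h1⟩

lemma int_crit {α γ C : ℝ} (hα : 0 < α) (hγ : -1 < γ) {g : ℝ → ℝ} (hg : Measurable g)
    (h1 : ∀ t, t ≠ 0 → |g t| ≤ C * |t| ^ γ) (h2 : ∀ t, t ≠ 0 → |g t| ≤ C * |t| ^ (-(1 + α))) :
    Integrable g := by
  have a1 := (near_int hγ).const_mul C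
  have a2 := (far_int (E := ℝ) volume (r := 1 + α) (by simp; linarith) 0 one_pos).const_mul C
  have hm : MeasurableSet {y : ℝ | 1 ≤ dist y 0} :=
    measurableSet_le measurable_const (by fun_prop)
  replace a2 := (integrable_indicator_iff hm).2 a2
  refine (a1.add a2).mono' hg.aestronglyMeasurable ?_
  have : ∀ᵐ t : ℝ, t ≠ 0 := by simp [ae_iff]
  filter_upwards [this] with t ht
  rw [Real.norm_eq_abs, Pi.add_apply]
  by_cases h : |t| < 1
  · rw [Set.indicator_of_mem (by exact h), Set.indicator_of_notMem (by simpa using h)]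
    simpa using h1 t ht
  · rw [Set.indicator_of_notMem (by simpa using h), Set.indicator_of_mem (by simpa using h)]
    simpa using h2 t ht

lemma FaInf_nonneg {α : ℝ} (hα : 0 < α) : 0 ≤ FaInf α := (abs_nonneg _).trans (Fa_abs hα 0)

lemma D2_int {α : ℝ} (hα : 0 < α) {u : ℝ → ℝ} (hu : Continuous u) {m₁ : ℝ} (hm₁ : 0 < m₁)
    (hu₁ : ∀ s, m₁ ≤ u s) (s : ℝ) :
    Integrable (fun t : ℝ => (Fa α ((u s + u (s - t)) / |t|) - FaInf α) * |t| ^ (-(1 + α))) := by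
  have hF := (Fa_cont hα).measurable
  have hF0 := FaInf_nonneg hα
  refine int_crit (C := max (m₁ ^ (-(1 + α))) (2 * FaInf α)) (γ := 0) hα (by norm_num) ?_ ?_ ?_
  · have : Measurable fun t : ℝ => (u s + u (s - t)) / |t| := by
      have := hu.measurable
      fun_prop
    exact ((hF.comp this).sub_const _).mul (by fun_prop)
  · intro t ht
    have h0 : 0 < |t| := abs_pos.2 ht
    have hQ : m₁ ≤ u s + u (s - t) := by linarith [hu₁ s, hu₁ (s - t)]
    have hQ0 := hm₁.trans_le hQ
    have a := Fa_tail_le hα (div_pos hQ0 h0)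
    have b := Fa_le hα ((u s + u (s - t)) / |t|)
    rw [abs_mul, abs_of_nonpos (by linarith : Fa α ((u s + u (s - t)) / |t|) - FaInf α ≤ 0),
      abs_of_nonneg (by positivity : 0 ≤ |t| ^ (-(1 + α))), neg_sub, Real.rpow_zero, mul_one]
    refine le_trans ?_ (le_max_left _ _)
    calc _ ≤ ((u s + u (s - t)) / |t|) ^ (-(1 + α)) * |t| ^ (-(1 + α)) := by gcongr
      _ = (u s + u (s - t)) ^ (-(1 + α)) := by
        rw [← Real.mul_rpow (by positivity) h0.le, div_mul_cancel₀ _ h0.ne']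
      _ ≤ _ := Real.rpow_le_rpow_of_nonpos hm₁ hQ (by linarith)
  · intro t ht
    rw [abs_mul, abs_of_nonneg (by positivity : 0 ≤ |t| ^ (-(1 + α)))]
    gcongr
    refine le_trans ?_ (le_max_right _ _)
    have a := abs_le.1 (Fa_abs hα ((u s + u (s - t)) / |t|))
    rw [abs_le]; constructor <;> linarith

lemma taylor {β M : ℝ} (hβ : 0 < β) {u : ℝ → ℝ} (hC1 : ContDiff ℝ 1 u)
    (hM0 : 0 ≤ M) (hM : ∀ s s', |deriv u s - deriv u s'| ≤ M * |s - s'| ^ β) (s t : ℝ) :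
    |u s - u (s - t) - deriv u s * t| ≤ M * |t| ^ β * |t| := by
  have hd : Differentiable ℝ u := hC1.differentiable (by norm_num)
  have hder : ∀ x, HasDerivAt (fun x => u x - deriv u s * x) (deriv u x - deriv u s) x := by
    intro x
    have := (hd x).hasDerivAt.sub ((hasDerivAt_id x).const_mul (deriv u s))
    rw [mul_one] at this
    exact this
  have := Convex.norm_image_sub_le_of_norm_deriv_le (f := fun x => u x - deriv u s * x)
    (s := Metric.closedBall s |t|) (x := s - t) (y := s) (C := M * |t| ^ β)
    (fun x _ => (hder x).differentiableAt) (fun x hx => ?_) (convex_closedBall _ _)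
    (by simp) (by simp)
  · simp only [Real.norm_eq_abs] at this
    convert this using 2 <;> ring_nf
  · rw [(hder x).deriv, Real.norm_eq_abs]
    refine (hM x s).trans ?_
    have : |x - s| ≤ |t| := by simpa [Real.dist_eq] using hx
    gcongr

lemma D1_int {α β : ℝ} (hα : 0 < α) (hβ : α < β) {u : ℝ → ℝ} (hC1 : ContDiff ℝ 1 u)
    (hHolder : ∃ M : ℝ, ∀ s s', |deriv u s - deriv u s'| ≤ M * |s - s'| ^ β) (s : ℝ) :
    Integrable (fun t : ℝ => (Fa α ((u s - u (s - t)) / |t|) - Fa α (deriv u s * t / |t|)) *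
      |t| ^ (-(1 + α))) := by
  obtain ⟨M, hM⟩ := hHolder
  have hM0 : 0 ≤ M := by
    have := (abs_nonneg _).trans (hM 1 0)
    simpa using this
  have hF := (Fa_cont hα).measurable
  have hF0 := FaInf_nonneg hα
  refine int_crit (C := max M (2 * FaInf α)) (γ := β - (1 + α)) hα (by linarith) ?_ ?_ ?_
  · have h1 : Measurable fun t : ℝ => (u s - u (s - t)) / |t| := by
      have := hC1.continuous.measurable
      fun_prop
    have h2 : Measurable fun t : ℝ => deriv u s * t / |t| := by fun_prop
    exact ((hF.comp h1).sub (hF.comp h2)).mul (by fun_prop)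
  · intro t ht
    have h0 : 0 < |t| := abs_pos.2 ht
    rw [abs_mul, abs_of_nonneg (by positivity : 0 ≤ |t| ^ (-(1 + α))), sub_eq_add_neg β,
      Real.rpow_add h0, ← mul_assoc]
    gcongr
    refine (Fa_lip hα _ _).trans ?_
    rw [← sub_div, abs_div, abs_abs, div_le_iff₀ h0]
    refine (taylor (hα.trans hβ) hC1 hM0 hM s t).trans ?_
    gcongr
    exact le_max_left _ _
  · intro t ht
    rw [abs_mul, abs_of_nonneg (by positivity : 0 ≤ |t| ^ (-(1 + α)))]
    gcongr
    refine le_trans ?_ (le_max_right _ _)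
    have a := abs_le.1 (Fa_abs hα ((u s - u (s - t)) / |t|))
    have b := abs_le.1 (Fa_abs hα (deriv u s * t / |t|))
    rw [abs_le]; constructor <;> linarith

lemma odd_zero {E : Type*} [NormedAddCommGroup E] [NormedSpace ℝ E] [FiniteDimensional ℝ E]
    [MeasurableSpace E] [BorelSpace E] (μ : Measure E) [μ.IsAddHaarMeasure] (x : E) (ε : ℝ)
    (f : E → ℝ) (hf : ∀ y, f (x + x - y) = - f y) :
    ∫ y in {y | ε ≤ dist y x}, f y ∂μ = 0 := by
  have hm : MeasurableSet {y : E | ε ≤ dist y x} :=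
    measurableSet_le measurable_const (by fun_prop)
  rw [← integral_indicator hm]
  have h := integral_sub_left_eq_self ({y : E | ε ≤ dist y x}.indicator f) μ (x + x)
  have e : ∀ y, {y : E | ε ≤ dist y x}.indicator f (x + x - y) =
      -{y : E | ε ≤ dist y x}.indicator f y := by
    intro y
    have : dist (x + x - y) x = dist y x := by
      rw [dist_eq_norm, dist_eq_norm, ← norm_neg]; congr 1; abel
    by_cases hy : ε ≤ dist y x
    · rw [Set.indicator_of_mem (by simpa [this] using hy), Set.indicator_of_mem (by exact hy), hf]
    · rw [Set.indicator_of_notMem (by simpa [this] using hy),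
        Set.indicator_of_notMem (by exact hy), neg_zero]
  simp only [e, integral_neg] at h
  linarith

lemma I_lim {α β : ℝ} (hα : 0 < α) (hβ : α < β) {u : ℝ → ℝ} (hC1 : ContDiff ℝ 1 u)
    (hHolder : ∃ M : ℝ, ∀ s s', |deriv u s - deriv u s'| ≤ M * |s - s'| ^ β) (s : ℝ) :
    Tendsto (fun ε : ℝ => ∫ t in {t : ℝ | ε ≤ |t|},
          Fa α ((u s - u (s - t)) / |t|) * |t| ^ (-(1 + α))) (𝓝[>] (0:ℝ))
      (𝓝 (∫ t, (Fa α ((u s - u (s - t)) / |t|) - Fa α (deriv u s * t / |t|)) *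
      |t| ^ (-(1 + α)))) := by
  have hne : ∀ᵐ t : ℝ, 0 < |t| := by
    have : ∀ᵐ t : ℝ, t ≠ 0 := by simp [ae_iff]
    filter_upwards [this] with t ht using abs_pos.2 ht
  have hF := (Fa_cont hα).measurable
  have hi := D1_int hα hβ hC1 hHolder s
  refine (pv_lim hi (N := fun t => |t|) (by fun_prop) hne).congr' ?_
  filter_upwards [self_mem_nhdsWithin] with ε hε
  have hz : ∫ t in {t : ℝ | ε ≤ |t|}, Fa α (deriv u s * t / |t|) * |t| ^ (-(1 + α)) = 0 := by
    have := odd_zero (E := ℝ) volume 0 ε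
      (fun t => Fa α (deriv u s * t / |t|) * |t| ^ (-(1 + α))) (fun t => by
        simp [neg_div, Fa_neg])
    simpa using this
  have hz' : IntegrableOn (fun t : ℝ => Fa α (deriv u s * t / |t|) * |t| ^ (-(1 + α)))
      {t : ℝ | ε ≤ |t|} := by
    have := far_int (E := ℝ) volume (r := 1 + α) (by simp; linarith) 0 hε
    simp only [dist_zero_left, dist_zero_right, Real.norm_eq_abs] at this
    refine Integrable.bdd_mul (c := FaInf α) this ?_ (Eventually.of_forall fun _ => Fa_abs hα _)
    exact (hF.comp (by fun_prop)).aestronglyMeasurable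
  have := integral_add hi.integrableOn hz'
  rw [hz, add_zero] at this
  rw [← this]
  congr 1
  ext t
  ring

lemma pt2_0 (a b : ℝ) : pt2 a b 0 = a := rfl
lemma pt2_1 (a b : ℝ) : pt2 a b 1 = b := rfl

lemma psi_mp (s c : ℝ) :
    MeasurePreserving (fun z : ℝ × ℝ => pt2 (s - z.1) (c + z.2)) volume volume := by
  have A : MeasurePreserving (fun x : ℝ => s - x) volume volume :=
    Measure.measurePreserving_sub_left volume s
  have B : MeasurePreserving (fun x : ℝ => c + x) volume volume := measurePreserving_add_left volume c
  exact (PiLp.volume_preserving_toLp (Fin 2)).comp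
    (((volume_preserving_finTwoArrow ℝ).symm).comp (A.prod B))

lemma psi_dist (α s c t z : ℝ) :
    dist (pt2 s c) (pt2 (s - t) (c + z)) ^ (-(2 + α)) = (t ^ 2 + z ^ 2) ^ (-(2 + α) / 2) := by
  rw [EuclideanSpace.dist_eq, Fin.sum_univ_two]
  simp only [pt2_0, pt2_1, Real.dist_eq, sq_abs]
  rw [Real.sqrt_eq_rpow, ← Real.rpow_mul (by positivity)]
  congr 1 <;> ring

lemma tauE_split (u : ℝ → ℝ) (hu : ∀ s, 0 < u s) (s t z : ℝ)
    (h1 : z ≠ u (s - t) - u s) (h2 : z ≠ -(u s + u (s - t))) :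
    tauE {p : EuclideanSpace ℝ (Fin 2) | -u (p 0) < p 1 ∧ p 1 < u (p 0)} (pt2 (s - t) (u s + z))
      = Real.sign (u (s - t) - u s - z) + (Real.sign (u s + u (s - t) + z) - 1) := by
  unfold tauE
  simp only [Set.mem_setOf_eq, pt2_0, pt2_1]
  have p1 := hu s
  have p2 := hu (s - t)
  rcases lt_or_gt_of_ne h1 with h1 | h1 <;> rcases lt_or_gt_of_ne h2 with h2 | h2
  · rw [if_neg (by rintro ⟨a, b⟩; linarith), Real.sign_of_pos (by linarith),
      Real.sign_of_neg (by linarith)]; norm_num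
  · rw [if_pos (by constructor <;> linarith), Real.sign_of_pos (by linarith),
      Real.sign_of_pos (by linarith)]; norm_num
  · linarith
  · rw [if_neg (by rintro ⟨a, b⟩; linarith), Real.sign_of_neg (by linarith),
      Real.sign_of_pos (by linarith)]; norm_num

lemma tauE_meas {E : Set (EuclideanSpace ℝ (Fin 2))} (hE : MeasurableSet E) :
    Measurable (tauE E) := Measurable.ite hE measurable_const measurable_const

lemma tauE_bdd (E : Set (EuclideanSpace ℝ (Fin 2))) (y) : |tauE E y| ≤ 1 := by
  unfold tauE; split_ifs <;> simp

/-- the plane integrand with the tangent half-plane subtracted -/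
noncomputable def gg (α : ℝ) (u : ℝ → ℝ) (s : ℝ) (E : Set (EuclideanSpace ℝ (Fin 2)))
    (y : EuclideanSpace ℝ (Fin 2)) : ℝ :=
  (tauE E y - Real.sign (deriv u s * (y 0 - s) - (y 1 - u s))) * dist (pt2 s (u s)) y ^ (-(2 + α))

lemma gg_main {α β : ℝ} (hα : 0 < α) (hβ : α < β) {u : ℝ → ℝ} (hC1 : ContDiff ℝ 1 u)
    (hHolder : ∃ M : ℝ, ∀ s s', |deriv u s - deriv u s'| ≤ M * |s - s'| ^ β) {m₁ : ℝ}
    (hm₁ : 0 < m₁) (hu₁ : ∀ s, m₁ ≤ u s)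
    {E : Set (EuclideanSpace ℝ (Fin 2))}
    (hE : E = {p : EuclideanSpace ℝ (Fin 2) | -u (p 0) < p 1 ∧ p 1 < u (p 0)})
    (hEm : MeasurableSet E) (s : ℝ) :
    Integrable (gg α u s E) ∧ ∫ y, gg α u s E y =
      -2 * (∫ t, (Fa α ((u s - u (s - t)) / |t|) - Fa α (deriv u s * t / |t|)) *
        |t| ^ (-(1 + α))) +
      2 * ∫ t : ℝ, (Fa α ((u s + u (s - t)) / |t|) - FaInf α) * |t| ^ (-(1 + α)) := by
  have hsm := sign_meas
  have htm := tauE_meas hEm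
  have hgm : Measurable (gg α u s E) := by
    unfold gg
    refine (htm.sub (hsm.comp ?_)).mul ?_ <;> fun_prop
  have hmp := psi_mp s (u s)
  have hD1 := D1_int hα hβ hC1 hHolder s
  have hD2 := D2_int hα hC1.continuous hm₁ hu₁ s
  set D1 := fun t : ℝ => (Fa α ((u s - u (s - t)) / |t|) - Fa α (deriv u s * t / |t|)) *
      |t| ^ (-(1 + α)) with hD1d
  set D2 := fun t : ℝ => (Fa α ((u s + u (s - t)) / |t|) - FaInf α) * |t| ^ (-(1 + α)) with hD2d
  set h : ℝ × ℝ → ℝ := fun z => gg α u s E (pt2 (s - z.1) (u s + z.2)) with hh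
  have hhm : Measurable h := hgm.comp hmp.measurable
  have key : ∀ t : ℝ, t ≠ 0 → Integrable (fun z => h (t, z)) ∧
      (∫ z, h (t, z) = -2 * D1 t + 2 * D2 t) ∧ ∫ z, ‖h (t, z)‖ ≤ 2 * |D1 t| + 2 * |D2 t| := by
    intro t ht
    obtain ⟨i1, v1, n1⟩ := slice1 hα ht (u (s - t) - u s) (-(deriv u s * t))
    obtain ⟨i2, v2, n2⟩ := slice2 hα ht (u s + u (s - t))
    have e1 : (Fa α ((u (s - t) - u s) / |t|) - Fa α (-(deriv u s * t) / |t|)) * |t| ^ (-(1 + α))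
        = - D1 t := by
      simp only [hD1d]
      rw [← neg_sub (u s), neg_div, neg_div, Fa_neg, Fa_neg]; ring
    rw [e1] at v1 n1
    rw [abs_neg] at n1
    set f1 := fun z : ℝ => (Real.sign (u (s - t) - u s - z) - Real.sign (-(deriv u s * t) - z)) *
      (t ^ 2 + z ^ 2) ^ (-(2 + α) / 2)
    set f2 := fun z : ℝ => (Real.sign (u s + u (s - t) + z) - 1) *
      (t ^ 2 + z ^ 2) ^ (-(2 + α) / 2)
    have hae : (fun z => h (t, z)) =ᵐ[volume] fun z => f1 z + f2 z := by
      have a1 : ∀ᵐ z : ℝ, z ≠ u (s - t) - u s := by simp [ae_iff]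
      have a2 : ∀ᵐ z : ℝ, z ≠ -(u s + u (s - t)) := by simp [ae_iff]
      filter_upwards [a1, a2] with z h1 h2
      simp only [hh, gg, f1, f2]
      rw [psi_dist, hE, tauE_split u (fun s => hm₁.trans_le (hu₁ s)) s t z h1 h2, pt2_0, pt2_1]
      have : deriv u s * (s - t - s) - (u s + z - u s) = -(deriv u s * t) - z := by ring
      rw [this]
      ring
    refine ⟨(i1.add i2).congr hae.symm, ?_, ?_⟩
    · rw [integral_congr_ae hae, integral_add i1 i2, v1, v2]; ring
    · rw [← n1, ← n2, ← integral_add i1.norm i2.norm]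
      refine integral_mono_ae ((i1.add i2).congr hae.symm).norm (i1.norm.add i2.norm) ?_
      filter_upwards [hae] with z hz
      rw [hz]
      exact norm_add_le _ _
  have hne : ∀ᵐ t : ℝ, t ≠ 0 := by simp [ae_iff]
  have hint : Integrable h (volume.prod volume) := by
    rw [integrable_prod_iff hhm.aestronglyMeasurable]
    refine ⟨?_, ?_⟩
    · filter_upwards [hne] with t ht using (key t ht).1
    · refine ((hD1.norm.const_mul 2).add (hD2.norm.const_mul 2)).mono'
        hhm.aestronglyMeasurable.norm.integral_prod_right' ?_
      filter_upwards [hne] with t ht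
      rw [Real.norm_of_nonneg (integral_nonneg fun _ => norm_nonneg _)]
      exact (key t ht).2.2
  refine ⟨(hmp.integrable_comp hgm.aestronglyMeasurable).1 hint, ?_⟩
  rw [← hmp.map_eq, integral_map hmp.measurable.aemeasurable hgm.aestronglyMeasurable]
  change ∫ z, h z ∂(volume.prod volume) = _
  rw [integral_prod _ hint, ← integral_const_mul, ← integral_const_mul,
    ← integral_add (hD1.const_mul _) (hD2.const_mul _)]
  refine integral_congr_ae ?_
  filter_upwards [hne] with t ht using (key t ht).2.1

lemma H_lim {α : ℝ} (hα : 0 < α) {u : ℝ → ℝ}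
    {E : Set (EuclideanSpace ℝ (Fin 2))} (hEm : MeasurableSet E) (s : ℝ)
    (hi : Integrable (gg α u s E)) :
    Tendsto (fun ε : ℝ => -∫ y in {y | ε ≤ dist y (pt2 s (u s))},
          tauE E y * dist (pt2 s (u s)) y ^ (-(2 + α))) (𝓝[>] (0:ℝ)) (𝓝 (-∫ y, gg α u s E y)) := by
  refine Tendsto.neg ?_
  have hsm := sign_meas
  have hne : ∀ᵐ y, 0 < dist y (pt2 s (u s)) := by
    have : ∀ᵐ y, y ≠ pt2 s (u s) := by simp [ae_iff]
    filter_upwards [this] with t ht using dist_pos.2 ht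
  refine (pv_lim hi (N := fun y => dist y (pt2 s (u s))) (by fun_prop) hne).congr' ?_
  filter_upwards [self_mem_nhdsWithin] with ε hε
  set f := fun y : EuclideanSpace ℝ (Fin 2) =>
    Real.sign (deriv u s * (y 0 - s) - (y 1 - u s)) * dist (pt2 s (u s)) y ^ (-(2 + α)) with hf
  have hz : ∫ y in {y | ε ≤ dist y (pt2 s (u s))}, f y = 0 := by
    apply odd_zero
    intro y
    have e1 : dist (pt2 s (u s)) (pt2 s (u s) + pt2 s (u s) - y) = dist (pt2 s (u s)) y := by
      rw [dist_eq_norm, dist_eq_norm, ← norm_neg]; congr 1; abel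
    simp only [hf]
    rw [e1, ← neg_mul, ← Real.sign_neg]
    congr 2
    simp only [PiLp.sub_apply, PiLp.add_apply, pt2_0, pt2_1]
    ring
  have hz' : IntegrableOn f {y | ε ≤ dist y (pt2 s (u s))} := by
    have := far_int (E := EuclideanSpace ℝ (Fin 2)) volume (r := 2 + α) (by simp; linarith)
      (pt2 s (u s)) hε
    refine Integrable.bdd_mul (c := 1) this ?_ (Eventually.of_forall fun _ => sign_bdd _)
    exact (hsm.comp (by fun_prop)).aestronglyMeasurable
  have := integral_add hi.integrableOn hz'
  rw [hz, add_zero] at this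
  rw [← this]
  congr 1
  ext y
  simp only [gg, hf]
  ring

end NMC

/-- **Graph formula for the nonlocal mean curvature of a band.** Let `u` be `C^{1,β}` with
`0 < m₁ ≤ u ≤ m₂` and let `E = {(s₁,s₂) : −u(s₁) < s₂ < u(s₁)} ⊆ ℝ²`. Then at every boundary
point `x = (s, u(s))` the principal value defining `H_E(x)` exists, the principal value
`I = lim_{ε→0} ∫_{|t|≥ε} F((u(s)−u(s−t))/|t|) |t|^{−1−α} dt` exists, the second integral
converges absolutely, and `H_E((s,u(s))) = 2I − 2∫_ℝ (F((u(s)+u(s−t))/|t|) − F(∞)) |t|^{−1−α} dt`. -/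
theorem nmc_of_band_graph
    (α β : ℝ) (hα : α ∈ Set.Ioo (0:ℝ) 1) (hβ : β ∈ Set.Ioo α 1)
    (u : ℝ → ℝ) (m₁ m₂ : ℝ) (hm₁ : 0 < m₁)
    (hu₁ : ∀ s, m₁ ≤ u s) (hu₂ : ∀ s, u s ≤ m₂)
    (hC1 : ContDiff ℝ 1 u)
    (hHolder : ∃ M : ℝ, ∀ s s', |deriv u s - deriv u s'| ≤ M * |s - s'| ^ β)
    (E : Set (EuclideanSpace ℝ (Fin 2)))
    (hE : E = {p : EuclideanSpace ℝ (Fin 2) | -u (p 0) < p 1 ∧ p 1 < u (p 0)})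
    (s : ℝ) :
    ∃ Hx I : ℝ,
      Tendsto (fun ε : ℝ => -∫ y in {y | ε ≤ dist y (pt2 s (u s))},
          tauE E y * dist (pt2 s (u s)) y ^ (-(2 + α))) (𝓝[>] (0:ℝ)) (𝓝 Hx) ∧
      Tendsto (fun ε : ℝ => ∫ t in {t : ℝ | ε ≤ |t|},
          Fa α ((u s - u (s - t)) / |t|) * |t| ^ (-(1 + α))) (𝓝[>] (0:ℝ)) (𝓝 I) ∧
      Integrable (fun t : ℝ => (Fa α ((u s + u (s - t)) / |t|) - FaInf α) * |t| ^ (-(1 + α))) ∧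
      Hx = 2 * I -
        2 * ∫ t : ℝ, (Fa α ((u s + u (s - t)) / |t|) - FaInf α) * |t| ^ (-(1 + α)) := by
  have hEm : MeasurableSet E := by
    have hu := hC1.continuous.measurable
    rw [hE]
    have h0 : Measurable fun p : EuclideanSpace ℝ (Fin 2) => u (p 0) := by fun_prop
    have h1 : Measurable fun p : EuclideanSpace ℝ (Fin 2) => p 1 := by fun_prop
    exact (measurableSet_lt h0.neg h1).inter (measurableSet_lt h1 h0)
  obtain ⟨hi, hv⟩ := NMC.gg_main hα.1 hβ.1 hC1 hHolder hm₁ hu₁ hE hEm s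
  refine ⟨_, _, NMC.H_lim hα.1 hEm s hi, NMC.I_lim hα.1 hβ.1 hC1 hHolder s,
    NMC.D2_int hα.1 hC1.continuous hm₁ hu₁ s, ?_⟩
  rw [hv]
  ring
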